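/- arXiv:2111.10553 — 7 statements merged into one kernel-verified Lean document; each statement's English description precedes it below -/
import Mathlib

section
/- Identifiability of DCDFM: suppose (P, Z, Θ) and (P̃, Z̃, Θ̃) are two parameter triples satisfying the DCDFM conditions (P and P̃ symmetric, full rank K, with maximum absolute entry 1; Z and Z̃ membership matrices of rank K; Θ and Θ̃ diagonal with strictly positive diagonal entries) such that Θ Z P Zᵀ Θ = Θ̃ Z̃ P̃ Z̃ᵀ Θ̃. Then Z = Z̃ up to a permutation of the K community labels; that is, the two label functions ℓ and ℓ̃ induce the same partition of {1,…,n}: ℓ(i) = ℓ(j) if and only if ℓ̃(i) = ℓ̃(j) for all i, j. -/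
open Matrix

/-- The rows of a real square matrix of full rank are linearly independent. -/
theorem Matrix.linearIndependent_row_of_rank_eq {K : ℕ} {P : Matrix (Fin K) (Fin K) ℝ}
    (hP : P.rank = K) : LinearIndependent ℝ P.row := by
  rw [linearIndependent_iff_card_eq_finrank_span, Set.finrank, ← Matrix.rank_eq_finrank_span_row,
    hP, Fintype.card_fin]

/-- Entries of the expectation matrix `Θ Z P Zᵀ Θ`. -/
theorem dcdfm_expectation_apply {n K : ℕ} {ℓ : Fin n → Fin K} {Z : Matrix (Fin n) (Fin K) ℝ}
    (hZ : ∀ i k, Z i k = if ℓ i = k then 1 else 0) (P : Matrix (Fin K) (Fin K) ℝ)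
    (θ : Fin n → ℝ) (i j : Fin n) :
    (Matrix.diagonal θ * Z * P * Zᵀ * Matrix.diagonal θ) i j
      = θ i * P (ℓ i) (ℓ j) * θ j := by
  rw [Matrix.mul_diagonal, Matrix.mul_apply]
  simp only [Matrix.mul_apply (N := P), Matrix.diagonal_mul, Matrix.transpose_apply, hZ]
  simp

/-- If two degree-corrected block structures agree entrywise and the second connectivity matrix
has full rank, then the first partition refines the second. -/
theorem label_eq_of_label_eq {n K : ℕ} {ℓ ℓt : Fin n → Fin K} (hℓt : Function.Surjective ℓt)
    {P Pt : Matrix (Fin K) (Fin K) ℝ} (hPt : Pt.rank = K) {θ θt : Fin n → ℝ}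
    (hθ : ∀ i, 0 < θ i) (hθt : ∀ i, 0 < θt i)
    (h : ∀ i j, θ i * P (ℓ i) (ℓ j) * θ j = θt i * Pt (ℓt i) (ℓt j) * θt j)
    {i j : Fin n} (hij : ℓ i = ℓ j) : ℓt i = ℓt j := by
  refine (Matrix.linearIndependent_row_of_rank_eq hPt).eq_of_smul_apply_eq_smul_apply
    (θ j * θt i) (θ i * θt j) _ _ (mul_pos (hθ j) (hθt i)).ne' ?_
  ext k
  obtain ⟨m, rfl⟩ := hℓt k
  have hi := h i m
  have hj := h j m
  rw [hij] at hi
  apply mul_right_cancel₀ (hθt m).ne'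
  simp only [Pi.smul_apply, smul_eq_mul, Matrix.row]
  linear_combination θ i * hj - θ j * hi

/-- **Identifiability of DCDFM.** If two eligible parameter triples `(P, Z, Θ)` and
`(P̃, Z̃, Θ̃)` (with `P, P̃` symmetric full-rank connectivity matrices having maximum
absolute entry `1`, `Z, Z̃` membership matrices coming from surjective label functions
`ℓ, ℓ̃`, and `Θ, Θ̃` diagonal with positive diagonal) produce the same expectation matrix
`Θ Z P Zᵀ Θ = Θ̃ Z̃ P̃ Z̃ᵀ Θ̃`, then the labels agree up to a permutation of the `K`
community labels, i.e. `ℓ` and `ℓ̃` induce the same partition of the nodes. -/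
theorem dcdfm_identifiability
    (n K : ℕ) [NeZero n] [NeZero K] (hKn : K ≤ n)
    (ℓ ℓt : Fin n → Fin K)
    (hℓ : Function.Surjective ℓ) (hℓt : Function.Surjective ℓt)
    (Z Zt : Matrix (Fin n) (Fin K) ℝ)
    (hZ : ∀ i k, Z i k = if ℓ i = k then 1 else 0)
    (hZt : ∀ i k, Zt i k = if ℓt i = k then 1 else 0)
    (P Pt : Matrix (Fin K) (Fin K) ℝ)
    (hPsymm : P.IsSymm) (hPtsymm : Pt.IsSymm)
    (hPrank : P.rank = K) (hPtrank : Pt.rank = K)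
    (hPle : ∀ k l, |P k l| ≤ 1) (hPeq : ∃ k l, |P k l| = 1)
    (hPtle : ∀ k l, |Pt k l| ≤ 1) (hPteq : ∃ k l, |Pt k l| = 1)
    (θ θt : Fin n → ℝ)
    (hθ : ∀ i, 0 < θ i) (hθt : ∀ i, 0 < θt i)
    (heq : Matrix.diagonal θ * Z * P * Zᵀ * Matrix.diagonal θ
         = Matrix.diagonal θt * Zt * Pt * Ztᵀ * Matrix.diagonal θt) :
    ∀ i j, ℓ i = ℓ j ↔ ℓt i = ℓt j := by
  have h : ∀ i j, θ i * P (ℓ i) (ℓ j) * θ j = θt i * Pt (ℓt i) (ℓt j) * θt j := fun i j => by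
    rw [← dcdfm_expectation_apply hZ, heq, dcdfm_expectation_apply hZt]
  exact fun i j => ⟨label_eq_of_label_eq hℓt hPtrank hθ hθt h,
    label_eq_of_label_eq hℓ hPrank hθt hθ fun i j => (h i j).symm⟩
end

section
/- Under DCDFM, the row-normalized eigenvector matrix satisfies U_* = Z B, where B = U_*(𝓘,:) and 𝓘 is any set of K node indices containing exactly one node from each community; equivalently, U_*(i,:) = U_*(j,:) whenever ℓ(i) = ℓ(j). -/
open Matrix

/-- The Euclidean norm of a row vector in `ℝ^K`. -/
noncomputable def rowNorm {K : ℕ} (v : Fin K → ℝ) : ℝ :=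
  Real.sqrt (∑ k, v k ^ 2)

theorem rowNorm_smul_of_pos {K : ℕ} {c : ℝ} (hc : 0 < c) (v : Fin K → ℝ) :
    rowNorm (c • v) = c * rowNorm v := by
  simp only [rowNorm, Pi.smul_apply, smul_eq_mul, mul_pow, ← Finset.mul_sum]
  rw [Real.sqrt_mul (sq_nonneg c), Real.sqrt_sq hc.le]

/-- The normalization of a vector is invariant under positive scaling. -/
theorem smul_apply_div_rowNorm {K : ℕ} {c : ℝ} (hc : 0 < c) (v : Fin K → ℝ) (k : Fin K) :
    (c • v) k / rowNorm (c • v) = v k / rowNorm v := by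
  rw [rowNorm_smul_of_pos hc, Pi.smul_apply, smul_eq_mul, mul_div_mul_left _ _ hc.ne.symm]

/-- The left factor `U` of a decomposition `A * M = U * diagonal d * Uᵀ` with orthonormal columns
and nonzero `d` factors through `A`. -/
theorem exists_eq_mul_of_eq_mul_diagonal_mul_transpose {m r s : Type*} [Fintype m] [Fintype r]
    [Fintype s] [DecidableEq r] {A : Matrix m s ℝ} {M : Matrix s m ℝ} {U : Matrix m r ℝ}
    {d : r → ℝ} (hd : ∀ k, d k ≠ 0) (hU : Uᵀ * U = 1)
    (h : A * M = U * Matrix.diagonal d * Uᵀ) : ∃ X : Matrix s r ℝ, U = A * X := by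
  have hdd : Matrix.diagonal d * Matrix.diagonal (fun k => (d k)⁻¹) = 1 := by
    simp [Matrix.diagonal_mul_diagonal, hd]
  refine ⟨M * U * Matrix.diagonal (fun k => (d k)⁻¹), ?_⟩
  rw [← Matrix.mul_assoc, ← Matrix.mul_assoc, h, Matrix.mul_assoc _ Uᵀ, hU, Matrix.mul_one,
    Matrix.mul_assoc, hdd, Matrix.mul_one]

/-- **Lemma 1 (paper).** Under DCDFM, the row-normalized eigenvector matrix satisfies
`U_* = Z B` where `B = U_*(𝓘,:)` for any set `𝓘` of `K` indices containing exactly one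
node from each community; equivalently `U_*(i,:) = U_*(j,:)` whenever `ℓ(i) = ℓ(j)`. -/
theorem dcdfm_rowNormalized_U_eq_ZB
    (n K : ℕ) [NeZero n] [NeZero K] (hKn : K ≤ n)
    (ℓ : Fin n → Fin K) (hℓ : Function.Surjective ℓ)
    (Z : Matrix (Fin n) (Fin K) ℝ)
    (hZ : ∀ i k, Z i k = if ℓ i = k then 1 else 0)
    (P : Matrix (Fin K) (Fin K) ℝ)
    (hPsymm : P.IsSymm) (hPrank : P.rank = K)
    (hPle : ∀ k l, |P k l| ≤ 1) (hPeq : ∃ k l, |P k l| = 1)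
    (θ : Fin n → ℝ) (hθ : ∀ i, 0 < θ i)
    (Om : Matrix (Fin n) (Fin n) ℝ)
    (hOm : Om = Matrix.diagonal θ * Z * P * Zᵀ * Matrix.diagonal θ)
    (U : Matrix (Fin n) (Fin K) ℝ)
    (Λ : Matrix (Fin K) (Fin K) ℝ) (d : Fin K → ℝ)
    (hΛ : Λ = Matrix.diagonal d) (hd : ∀ k, d k ≠ 0)
    (hU : Uᵀ * U = 1)
    (hdec : Om = U * Λ * Uᵀ)
    (hUrow : ∀ i, U i ≠ 0)
    (Ustar : Matrix (Fin n) (Fin K) ℝ)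
    (hUstar : Ustar = Matrix.of fun i k => U i k / rowNorm (U i))
    (𝓘 : Fin K → Fin n) (h𝓘 : ∀ k, ℓ (𝓘 k) = k)
    (B : Matrix (Fin K) (Fin K) ℝ)
    (hB : B = Matrix.of fun k => Ustar (𝓘 k)) :
    Ustar = Z * B ∧ ∀ i j, ℓ i = ℓ j → Ustar i = Ustar j := by
  have hZmul (X : Matrix (Fin K) (Fin K) ℝ) (i : Fin n) : (Z * X) i = X (ℓ i) := by
    ext k
    simp [Matrix.mul_apply, hZ]
  obtain ⟨X, hX⟩ : ∃ X : Matrix (Fin K) (Fin K) ℝ, U = Matrix.diagonal θ * Z * X := by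
    refine exists_eq_mul_of_eq_mul_diagonal_mul_transpose
      (M := P * Zᵀ * Matrix.diagonal θ) hd hU ?_
    rw [← hΛ, ← hdec, hOm]
    simp only [Matrix.mul_assoc]
  have hUi (i : Fin n) : U i = θ i • X (ℓ i) := by
    ext k
    rw [hX, Matrix.mul_assoc, Matrix.diagonal_mul, hZmul, Pi.smul_apply, smul_eq_mul]
  have hconst (i j : Fin n) (hij : ℓ i = ℓ j) : Ustar i = Ustar j := by
    ext k
    simp only [hUstar, Matrix.of_apply]
    rw [hUi i, hUi j, smul_apply_div_rowNorm (hθ i), smul_apply_div_rowNorm (hθ j), hij]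
  refine ⟨?_, hconst⟩
  ext i k
  rw [hZmul, hB, Matrix.of_apply, hconst i (𝓘 (ℓ i)) (h𝓘 (ℓ i)).symm]
end

section
/- Under DCDFM, the K-th largest eigenvalue of the positive semidefinite matrix Ω Ωᵀ satisfies λ_K(ΩΩᵀ) ≥ θ_min⁴ · n_min² · λ_K(P)², where λ_K(P) denotes the smallest-in-magnitude eigenvalue of P. Equivalently, the K-th largest singular value of Ω satisfies σ_K(Ω) ≥ θ_min² · |λ_K(P)| · n_min. -/
open Matrix

/-- A real Hermitian matrix is orthogonally diagonalized by its eigenvalues. -/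
theorem Matrix.IsHermitian.exists_orthogonal_diagonalization {ι : Type*} [Fintype ι]
    [DecidableEq ι] {A : Matrix ι ι ℝ} (hA : A.IsHermitian) :
    ∃ U : Matrix ι ι ℝ, Uᵀ * U = 1 ∧ U * Uᵀ = 1 ∧ A = U * diagonal hA.eigenvalues * Uᵀ := by
  have h := hA.spectral_theorem
  have h₁ := Unitary.coe_star_mul_self hA.eigenvectorUnitary
  have h₂ := Unitary.coe_mul_star_self hA.eigenvectorUnitary
  rw [Unitary.conjStarAlgAut_apply] at h
  simp only [star_eq_conjTranspose, conjTranspose_eq_transpose_of_trivial] at h h₁ h₂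
  exact ⟨hA.eigenvectorUnitary, h₁, h₂, h⟩

theorem Matrix.mulVec_dotProduct_mulVec {m n : Type*} [Fintype m] [Fintype n]
    (M : Matrix m n ℝ) (v w : n → ℝ) : (M *ᵥ v) ⬝ᵥ (M *ᵥ w) = v ⬝ᵥ ((Mᵀ * M) *ᵥ w) := by
  rw [← mulVec_mulVec, dotProduct_mulVec v, vecMul_transpose]

/-- If a quadratic form is at least `c` times the squared norm on the range of an injective
matrix with `κ` columns, then at least `κ` of its eigenvalues (with multiplicity) are at
least `c`. -/
theorem Matrix.IsHermitian.card_le_card_eigenvalues_ge {ι κ : Type*} [Fintype ι]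
    [DecidableEq ι] [Fintype κ] {A : Matrix ι ι ℝ} (hA : A.IsHermitian) (B : Matrix ι κ ℝ)
    (hB : Function.Injective B.mulVec) (c : ℝ)
    (h : ∀ x, c * ((B *ᵥ x) ⬝ᵥ (B *ᵥ x)) ≤ (B *ᵥ x) ⬝ᵥ (A *ᵥ (B *ᵥ x))) :
    Fintype.card κ ≤ (Finset.univ.filter fun i => c ≤ hA.eigenvalues i).card := by
  obtain ⟨U, hUU, hUU', hAU⟩ := hA.exists_orthogonal_diagonalization
  let coords : (κ → ℝ) →ₗ[ℝ] ({i // c ≤ hA.eigenvalues i} → ℝ) :=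
    LinearMap.funLeft ℝ ℝ Subtype.val ∘ₗ (Uᵀ * B).mulVecLin
  have hinj : Function.Injective coords := by
    rw [← LinearMap.ker_eq_bot, LinearMap.ker_eq_bot']
    intro x hx
    set z := Uᵀ *ᵥ (B *ᵥ x) with hz
    have hzero : ∀ i, c ≤ hA.eigenvalues i → z i = 0 := by
      intro i hi
      have hxi : ((Uᵀ * B) *ᵥ x) i = 0 := congrFun hx ⟨i, hi⟩
      rwa [← mulVec_mulVec] at hxi
    have hy : B *ᵥ x = U *ᵥ z := by rw [hz, mulVec_mulVec, hUU', one_mulVec]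
    have hq := h x
    have hnorm : (B *ᵥ x) ⬝ᵥ (B *ᵥ x) = ∑ i, z i * z i := by
      rw [hy, mulVec_dotProduct_mulVec, hUU, one_mulVec]; rfl
    have hform : (B *ᵥ x) ⬝ᵥ (A *ᵥ (B *ᵥ x)) = ∑ i, z i * (hA.eigenvalues i * z i) := by
      conv_lhs => rw [hAU, ← mulVec_mulVec, ← hz, hy, ← mulVec_mulVec, mulVec_dotProduct_mulVec,
        hUU, one_mulVec]
      simp [dotProduct, mulVec_diagonal]
    rw [hnorm, hform, Finset.mul_sum, ← sub_nonpos, ← Finset.sum_sub_distrib] at hq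
    have hterm : ∀ i, 0 ≤ c * (z i * z i) - z i * (hA.eigenvalues i * z i) := by
      intro i
      by_cases hi : c ≤ hA.eigenvalues i
      · simp [hzero i hi]
      · nlinarith [mul_self_nonneg (z i)]
    have hall := (Finset.sum_eq_zero_iff_of_nonneg fun i _ => hterm i).1
      (le_antisymm hq (Finset.sum_nonneg fun i _ => hterm i))
    have hz0 : z = 0 := by
      funext i
      by_cases hi : c ≤ hA.eigenvalues i
      · exact hzero i hi
      · have h0 : (c - hA.eigenvalues i) * (z i * z i) = 0 := by
          linear_combination hall i (Finset.mem_univ i)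
        exact mul_self_eq_zero.1
          ((mul_eq_zero.1 h0).resolve_left (sub_pos.2 (not_le.1 hi)).ne')
    apply hB
    rw [hy, hz0, mulVec_zero, mulVec_zero]
  have := LinearMap.finrank_le_finrank_of_injective hinj
  simpa [Module.finrank_fintype_fun_eq_card, Fintype.card_subtype] using this

/-- A symmetric matrix expands squared norms by at least the square of any lower bound on the
absolute values of its eigenvalues. -/
theorem Matrix.IsHermitian.sq_mul_dotProduct_le {ι : Type*} [Fintype ι] [DecidableEq ι]
    {A : Matrix ι ι ℝ} (hA : A.IsHermitian) {r : ℝ} (hr : 0 ≤ r)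
    (h : ∀ i, r ≤ |hA.eigenvalues i|) (v : ι → ℝ) :
    r ^ 2 * (v ⬝ᵥ v) ≤ (A *ᵥ v) ⬝ᵥ (A *ᵥ v) := by
  obtain ⟨U, hUU, hUU', hAU⟩ := hA.exists_orthogonal_diagonalization
  set z := Uᵀ *ᵥ v with hz
  have hv : v = U *ᵥ z := by rw [hz, mulVec_mulVec, hUU', one_mulVec]
  have hnorm : v ⬝ᵥ v = ∑ i, z i * z i := by
    rw [hv, mulVec_dotProduct_mulVec, hUU, one_mulVec]; rfl
  have hAv : A *ᵥ v = U *ᵥ (diagonal hA.eigenvalues *ᵥ z) := by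
    conv_lhs => rw [hAU, ← mulVec_mulVec, ← hz, ← mulVec_mulVec]
  rw [hnorm, hAv, mulVec_dotProduct_mulVec, hUU, one_mulVec, Finset.mul_sum]
  refine Finset.sum_le_sum fun i _ => ?_
  have hsq : r ^ 2 ≤ hA.eigenvalues i ^ 2 := by
    rw [← sq_abs (hA.eigenvalues i)]
    exact pow_le_pow_left₀ hr (h i) 2
  rw [mulVec_diagonal]
  nlinarith [mul_le_mul_of_nonneg_right hsq (mul_self_nonneg (z i))]

/-- If the columns of `B` are orthogonal with squared norms at least `m`, then `B * P * Bᵀ`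
expands squared norms on the range of `B` by at least `m ^ 2 * r ^ 2`, where `r` bounds the
absolute values of the eigenvalues of `P` from below. -/
theorem Matrix.IsHermitian.quadratic_form_conj_ge {ι κ : Type*} [Fintype ι] [Fintype κ]
    [DecidableEq κ] {P : Matrix κ κ ℝ} (hP : P.IsHermitian) {r : ℝ} (hr : 0 ≤ r)
    (hrP : ∀ k, r ≤ |hP.eigenvalues k|) {B : Matrix ι κ ℝ} {d : κ → ℝ}
    (hB : Bᵀ * B = diagonal d) {m : ℝ} (hm : 0 ≤ m) (hd : ∀ k, m ≤ d k) (x : κ → ℝ) :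
    m ^ 2 * r ^ 2 * ((B *ᵥ x) ⬝ᵥ (B *ᵥ x)) ≤
      (B *ᵥ x) ⬝ᵥ ((B * P * Bᵀ * (B * P * Bᵀ)ᵀ) *ᵥ (B *ᵥ x)) := by
  have hPT : Pᵀ = P := hP
  have hsymm : (B * P * Bᵀ)ᵀ = B * P * Bᵀ := by
    simp [transpose_mul, hPT, Matrix.mul_assoc]
  set w := diagonal d *ᵥ x with hw
  have hOm : (B * P * Bᵀ) *ᵥ (B *ᵥ x) = B *ᵥ (P *ᵥ w) := by
    simp only [hw, ← hB, mulVec_mulVec, Matrix.mul_assoc]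
  have hform : (B *ᵥ x) ⬝ᵥ ((B * P * Bᵀ * (B * P * Bᵀ)ᵀ) *ᵥ (B *ᵥ x)) =
      (P *ᵥ w) ⬝ᵥ (diagonal d *ᵥ (P *ᵥ w)) := by
    rw [← hB, ← mulVec_dotProduct_mulVec, ← hOm, mulVec_dotProduct_mulVec, hsymm]
  have h₁ : m * ((P *ᵥ w) ⬝ᵥ (P *ᵥ w)) ≤ (P *ᵥ w) ⬝ᵥ (diagonal d *ᵥ (P *ᵥ w)) := by
    simp only [dotProduct, Finset.mul_sum, mulVec_diagonal]
    refine Finset.sum_le_sum fun k _ => ?_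
    nlinarith [mul_le_mul_of_nonneg_right (hd k) (mul_self_nonneg ((P *ᵥ w) k))]
  have h₂ := hP.sq_mul_dotProduct_le hr hrP w
  have h₃ : m * (x ⬝ᵥ w) ≤ w ⬝ᵥ w := by
    simp only [dotProduct, Finset.mul_sum, hw, mulVec_diagonal]
    refine Finset.sum_le_sum fun k _ => ?_
    have hdk : m * d k ≤ d k * d k := mul_le_mul_of_nonneg_right (hd k) (hm.trans (hd k))
    nlinarith [mul_le_mul_of_nonneg_right hdk (mul_self_nonneg (x k))]
  rw [hform, mulVec_dotProduct_mulVec, hB, ← hw]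
  calc m ^ 2 * r ^ 2 * (x ⬝ᵥ w) = m * (r ^ 2 * (m * (x ⬝ᵥ w))) := by ring
    _ ≤ m * (r ^ 2 * (w ⬝ᵥ w)) := by gcongr
    _ ≤ m * ((P *ᵥ w) ⬝ᵥ (P *ᵥ w)) := by gcongr
    _ ≤ _ := h₁

/-- Scaled membership matrices have orthogonal columns. -/
theorem Matrix.transpose_mul_self_diagonal_mul_membership {ι κ : Type*} [Fintype ι]
    [DecidableEq ι] [DecidableEq κ] (ℓ : ι → κ) (θ : ι → ℝ) (Z : Matrix ι κ ℝ)
    (hZ : ∀ i k, Z i k = if ℓ i = k then 1 else 0) :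
    (diagonal θ * Z)ᵀ * (diagonal θ * Z) =
      diagonal fun k => ∑ i ∈ Finset.univ.filter (fun i => ℓ i = k), θ i ^ 2 := by
  ext k l
  simp only [mul_apply (M := (diagonal θ * Z)ᵀ), transpose_apply, diagonal_mul, hZ,
    diagonal_apply]
  split_ifs with hkl
  · subst hkl
    rw [Finset.sum_filter]
    refine Finset.sum_congr rfl fun i _ => ?_
    split_ifs <;> ring
  · refine Finset.sum_eq_zero fun i _ => ?_
    by_cases hk : ℓ i = k
    · have hl : ℓ i ≠ l := fun hl => hkl (hk.symm.trans hl)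
      simp [hl]
    · simp [hk]

/-- **Lemma 3 (paper).** Under DCDFM, the `K`-th largest eigenvalue of the positive
semidefinite matrix `Ω Ωᵀ` is at least `θ_min⁴ n_min² λ_K(P)²`, where `λ_K(P)` is the
smallest-in-magnitude eigenvalue of `P`; equivalently (since singular values of `Ω` are
square roots of eigenvalues of `Ω Ωᵀ`), `σ_K(Ω) ≥ θ_min² |λ_K(P)| n_min`.  Here
"the `K`-th largest value is ≥ c" is expressed as "at least `K` of the values
(with multiplicity) are ≥ c". -/
theorem dcdfm_lambdaK_OmegaOmegaT_lower_bound
    (n K : ℕ) [NeZero n] [NeZero K] (hKn : K ≤ n)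
    (ℓ : Fin n → Fin K) (hℓ : Function.Surjective ℓ)
    (Z : Matrix (Fin n) (Fin K) ℝ)
    (hZ : ∀ i k, Z i k = if ℓ i = k then 1 else 0)
    (P : Matrix (Fin K) (Fin K) ℝ)
    (hPsymm : P.IsSymm) (hPrank : P.rank = K)
    (hPle : ∀ k l, |P k l| ≤ 1) (hPeq : ∃ k l, |P k l| = 1)
    (θ : Fin n → ℝ) (hθ : ∀ i, 0 < θ i)
    (Om : Matrix (Fin n) (Fin n) ℝ)
    (hOm : Om = Matrix.diagonal θ * Z * P * Zᵀ * Matrix.diagonal θ)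
    (θmin : ℝ) (hθmin : θmin = Finset.univ.inf' Finset.univ_nonempty θ)
    (nmin : ℕ)
    (hnmin : nmin = Finset.univ.inf' Finset.univ_nonempty
        fun k => (Finset.univ.filter fun i => ℓ i = k).card)
    (hPH : P.IsHermitian) (hW : (Om * Omᵀ).IsHermitian)
    (lamKP : ℝ)
    (hlamKP : lamKP = Finset.univ.inf' Finset.univ_nonempty
        fun k => |hPH.eigenvalues k|) :
    K ≤ (Finset.univ.filter fun i =>
          θmin ^ 4 * (nmin : ℝ) ^ 2 * lamKP ^ 2 ≤ hW.eigenvalues i).card ∧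
      K ≤ (Finset.univ.filter fun i =>
          θmin ^ 2 * lamKP * (nmin : ℝ) ≤ Real.sqrt (hW.eigenvalues i)).card := by
  subst hOm
  have hθmin_pos : 0 < θmin := by
    rw [hθmin, Finset.lt_inf'_iff]
    exact fun i _ => hθ i
  have hθmin_le : ∀ i, θmin ≤ θ i := fun i => hθmin ▸ Finset.inf'_le _ (Finset.mem_univ i)
  have hnmin_pos : 0 < nmin := by
    rw [hnmin, Finset.lt_inf'_iff]
    intro k _
    obtain ⟨i, hi⟩ := hℓ k
    exact Finset.card_pos.2 ⟨i, by simp [hi]⟩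
  have hnmin_le : ∀ k, nmin ≤ (Finset.univ.filter fun i => ℓ i = k).card := fun k =>
    hnmin ▸ Finset.inf'_le (fun k => (Finset.univ.filter fun i => ℓ i = k).card)
      (Finset.mem_univ k)
  have hlam_nonneg : 0 ≤ lamKP := by
    rw [hlamKP, Finset.le_inf'_iff]
    exact fun k _ => abs_nonneg _
  have hlam_le : ∀ k, lamKP ≤ |hPH.eigenvalues k| := fun k =>
    hlamKP ▸ Finset.inf'_le (fun k => |hPH.eigenvalues k|) (Finset.mem_univ k)
  have hgram := transpose_mul_self_diagonal_mul_membership ℓ θ Z hZ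
  set d : Fin K → ℝ := fun k => ∑ i ∈ Finset.univ.filter (fun i => ℓ i = k), θ i ^ 2
  have hm_pos : 0 < θmin ^ 2 * (nmin : ℝ) := by positivity
  have hd : ∀ k, θmin ^ 2 * (nmin : ℝ) ≤ d k := by
    intro k
    calc θmin ^ 2 * (nmin : ℝ)
        ≤ θmin ^ 2 * ((Finset.univ.filter fun i => ℓ i = k).card : ℝ) := by
          gcongr
          exact hnmin_le k
      _ = ∑ _i ∈ Finset.univ.filter (fun i => ℓ i = k), θmin ^ 2 := by
          rw [Finset.sum_const, nsmul_eq_mul, mul_comm]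
      _ ≤ d k := Finset.sum_le_sum fun i _ => pow_le_pow_left₀ hθmin_pos.le (hθmin_le i) 2
  have hinj : Function.Injective (diagonal θ * Z).mulVec := by
    intro x y hxy
    have hxy' := congrArg ((diagonal θ * Z)ᵀ *ᵥ ·) hxy
    simp only [mulVec_mulVec (N := diagonal θ * Z), hgram] at hxy'
    funext k
    have hk := congrFun hxy' k
    rw [mulVec_diagonal, mulVec_diagonal] at hk
    exact mul_left_cancel₀ (hm_pos.trans_le (hd k)).ne' hk
  have hOm_eq : diagonal θ * Z * P * Zᵀ * diagonal θ =
      (diagonal θ * Z) * P * (diagonal θ * Z)ᵀ := by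
    simp [transpose_mul, Matrix.mul_assoc]
  have hcount : K ≤ (Finset.univ.filter fun i =>
      θmin ^ 4 * (nmin : ℝ) ^ 2 * lamKP ^ 2 ≤ hW.eigenvalues i).card := by
    have := hW.card_le_card_eigenvalues_ge (diagonal θ * Z) hinj
      (θmin ^ 4 * (nmin : ℝ) ^ 2 * lamKP ^ 2) fun x => by
        have hx := hPH.quadratic_form_conj_ge hlam_nonneg hlam_le hgram hm_pos.le hd x
        rw [hOm_eq]
        convert hx using 2
        ring
    simpa using this
  refine ⟨hcount, hcount.trans (Finset.card_le_card ?_)⟩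
  refine Finset.monotone_filter_right _ fun i _ hi => Real.le_sqrt_of_sq_le ?_
  calc (θmin ^ 2 * lamKP * (nmin : ℝ)) ^ 2 = θmin ^ 4 * (nmin : ℝ) ^ 2 * lamKP ^ 2 := by ring
    _ ≤ _ := hi
end

section
/- Let V, W ∈ ℝ^{n×K} be matrices all of whose rows are nonzero, and let V_*, W_* denote their row-normalized versions (V_*(i,:) = V(i,:)/‖V(i,:)‖ and similarly for W). Set m_W = min_{i} ‖W(i,:)‖. Then ‖V_* − W_*‖_F ≤ 2 ‖V − W‖_F / m_W, where ‖·‖_F is the Frobenius norm. (Applied in the paper with V = Û𝒪 and W = U to get ‖Û_*𝒪 − U_*‖_F ≤ 2‖Û𝒪 − U‖_F/m_U.) -/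
open Matrix

/-- The Frobenius norm of an `n × K` real matrix. -/
noncomputable def frobNorm {n K : ℕ} (M : Matrix (Fin n) (Fin K) ℝ) : ℝ :=
  Real.sqrt (∑ i, ∑ k, M i k ^ 2)

theorem norm_inv_norm_smul_sub_le {E : Type*} [NormedAddCommGroup E] [NormedSpace ℝ E]
    {v w : E} (hv : v ≠ 0) (hw : w ≠ 0) :
    ‖‖v‖⁻¹ • v - ‖w‖⁻¹ • w‖ ≤ 2 * ‖v - w‖ / ‖w‖ := by
  have hv' : 0 < ‖v‖ := norm_pos_iff.mpr hv
  have hw' : 0 < ‖w‖ := norm_pos_iff.mpr hw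
  have key : ‖v‖⁻¹ • v - ‖w‖⁻¹ • w
      = ‖w‖⁻¹ • ((v - w) + ((‖w‖ - ‖v‖) * ‖v‖⁻¹) • v) := by
    match_scalars <;> field_simp
    ring
  have hproj : ‖((‖w‖ - ‖v‖) * ‖v‖⁻¹) • v‖ ≤ ‖v - w‖ := by
    rw [norm_smul, norm_mul, norm_inv, norm_norm, mul_assoc, inv_mul_cancel₀ hv'.ne', mul_one,
      norm_sub_rev v w]
    exact abs_norm_sub_norm_le w v
  rw [key, norm_smul, norm_inv, norm_norm, div_eq_inv_mul]
  gcongr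
  linarith [norm_add_le (v - w) (((‖w‖ - ‖v‖) * ‖v‖⁻¹) • v)]

theorem rowNorm_eq_norm_toLp {K : ℕ} (v : Fin K → ℝ) :
    rowNorm v = ‖WithLp.toLp 2 v‖ := by
  simp [rowNorm, EuclideanSpace.norm_eq]

theorem rowNorm_pos {K : ℕ} {v : Fin K → ℝ} (hv : v ≠ 0) : 0 < rowNorm v := by
  rw [rowNorm_eq_norm_toLp, norm_pos_iff]
  simpa using hv

theorem rowNorm_sq {K : ℕ} (v : Fin K → ℝ) : rowNorm v ^ 2 = ∑ k, v k ^ 2 :=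
  Real.sq_sqrt (Finset.sum_nonneg fun _ _ => sq_nonneg _)

theorem rowNorm_normalized_sub_le {K : ℕ} {v w : Fin K → ℝ} (hv : v ≠ 0) (hw : w ≠ 0) :
    rowNorm (fun k => v k / rowNorm v - w k / rowNorm w)
      ≤ 2 * rowNorm (v - w) / rowNorm w := by
  have h := norm_inv_norm_smul_sub_le (v := WithLp.toLp 2 v) (w := WithLp.toLp 2 w)
    (by simpa using hv) (by simpa using hw)
  rw [← rowNorm_eq_norm_toLp, ← rowNorm_eq_norm_toLp, ← WithLp.toLp_smul, ← WithLp.toLp_smul,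
    ← WithLp.toLp_sub, ← WithLp.toLp_sub, ← rowNorm_eq_norm_toLp, ← rowNorm_eq_norm_toLp] at h
  convert h using 2
  ext k
  simp [div_eq_inv_mul]

theorem frobNorm_eq_sqrt_sum_rowNorm_sq {n K : ℕ} (M : Matrix (Fin n) (Fin K) ℝ) :
    frobNorm M = Real.sqrt (∑ i, rowNorm (M i) ^ 2) := by
  simp only [frobNorm, rowNorm_sq]

theorem frobNorm_le_mul_of_rowNorm_le {n K : ℕ} {M N : Matrix (Fin n) (Fin K) ℝ} {c : ℝ}
    (hc : 0 ≤ c) (h : ∀ i, rowNorm (M i) ≤ c * rowNorm (N i)) :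
    frobNorm M ≤ c * frobNorm N := by
  rw [frobNorm_eq_sqrt_sum_rowNorm_sq, frobNorm_eq_sqrt_sum_rowNorm_sq]
  refine Real.sqrt_le_iff.mpr ⟨by positivity, ?_⟩
  rw [mul_pow, Real.sq_sqrt (by positivity), Finset.mul_sum]
  refine Finset.sum_le_sum fun i _ => ?_
  rw [← mul_pow]
  exact pow_le_pow_left₀ (Real.sqrt_nonneg _) (h i) 2

/-- For matrices `V, W ∈ ℝ^{n×K}` with all rows nonzero and row-normalized versions
`V_*, W_*`, one has `‖V_* − W_*‖_F ≤ 2 ‖V − W‖_F / m_W`, where `m_W = min_i ‖W(i,:)‖`. -/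
theorem rowNormalized_frobenius_perturbation
    (n K : ℕ) [NeZero n]
    (V W : Matrix (Fin n) (Fin K) ℝ)
    (hV : ∀ i, V i ≠ 0) (hW : ∀ i, W i ≠ 0) :
    frobNorm ((Matrix.of fun i k => V i k / rowNorm (V i))
        - (Matrix.of fun i k => W i k / rowNorm (W i)))
      ≤ 2 * frobNorm (V - W)
        / (Finset.univ.inf' Finset.univ_nonempty fun i => rowNorm (W i)) := by
  set m := Finset.univ.inf' Finset.univ_nonempty fun i => rowNorm (W i)
  have hm_pos : 0 < m := (Finset.lt_inf'_iff _).mpr fun i _ => rowNorm_pos (hW i)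
  rw [mul_div_right_comm]
  refine frobNorm_le_mul_of_rowNorm_le (by positivity) fun i => ?_
  have hmi : m ≤ rowNorm (W i) := Finset.inf'_le _ (Finset.mem_univ i)
  have hnn : 0 ≤ rowNorm (V i - W i) := Real.sqrt_nonneg _
  calc rowNorm _ ≤ 2 * rowNorm (V i - W i) / rowNorm (W i) :=
        rowNorm_normalized_sub_le (hV i) (hW i)
    _ ≤ 2 * rowNorm (V i - W i) / m := by gcongr
    _ = 2 / m * rowNorm ((V - W) i) := mul_div_right_comm _ _ _
end

section
/- Under DCDFM, every row of U is bounded below in norm: for all i ∈ {1,…,n}, ‖U(i,:)‖_F ≥ θ_min/(θ_max √n_max). Equivalently, m_U = min_i ‖U(i,:)‖_F satisfies 1/m_U ≤ θ_max √n_max / θ_min. -/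
open Matrix

/-- If the columns of `W * B` are orthonormal and row `i` of `W` has its only nonzero entry `θ i`
at `ℓ i`, then the squared norm of row `i` of `W * B`, multiplied by `∑ θ j ^ 2` over the
community of `i`, equals `θ i ^ 2`. -/
theorem row_sq_mul_community_sum {ι κ : Type*} [Fintype ι] [Fintype κ] [DecidableEq κ]
    (ℓ : ι → κ) (θ : ι → ℝ) (W U : Matrix ι κ ℝ) (B : Matrix κ κ ℝ)
    (hW : ∀ i k, W i k = if ℓ i = k then θ i else 0)
    (hUB : U = W * B) (hU : Uᵀ * U = 1) (i : ι) :
    (∑ k, U i k ^ 2) * (∑ j with ℓ j = ℓ i, θ j ^ 2) = θ i ^ 2 := by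
  have hentry : ∀ k, U i k = θ i * B (ℓ i) k := fun k => by
    simp [hUB, Matrix.mul_apply, hW]
  have hgram : Wᵀ * W = Matrix.diagonal fun k => ∑ j with ℓ j = k, θ j ^ 2 := by
    ext k l
    rw [Matrix.mul_apply, Matrix.diagonal_apply, Finset.sum_filter]
    split_ifs with hkl
    · subst hkl
      refine Finset.sum_congr rfl fun j _ => ?_
      simp only [Matrix.transpose_apply, hW]
      split_ifs <;> ring
    · refine Finset.sum_eq_zero fun j _ => ?_
      simp only [Matrix.transpose_apply, hW]
      split_ifs with h₁ h₂
      · exact absurd (h₁.symm.trans h₂) hkl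
      all_goals simp
  have hleft : (Bᵀ * (Wᵀ * W)) * B = 1 := by
    rw [← hU, hUB, Matrix.transpose_mul]
    simp only [Matrix.mul_assoc]
  have hright : B * Bᵀ * (Wᵀ * W) = 1 := by
    rw [Matrix.mul_assoc]
    exact mul_eq_one_comm.mp hleft
  have hdiag := congrFun (congrFun hright (ℓ i)) (ℓ i)
  rw [hgram, Matrix.mul_diagonal, Matrix.one_apply_eq, Matrix.mul_apply] at hdiag
  calc (∑ k, U i k ^ 2) * (∑ j with ℓ j = ℓ i, θ j ^ 2)
      = θ i ^ 2 * ((∑ k, B (ℓ i) k * Bᵀ k (ℓ i)) * ∑ j with ℓ j = ℓ i, θ j ^ 2) := by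
        rw [← mul_assoc, Finset.mul_sum Finset.univ]
        congr 1
        refine Finset.sum_congr rfl fun k _ => ?_
        rw [hentry, Matrix.transpose_apply]
        ring
    _ = θ i ^ 2 := by rw [hdiag, mul_one]

/-- Under DCDFM, every row of the eigenvector matrix `U` is bounded below in norm:
`‖U(i,:)‖_F ≥ θ_min/(θ_max √n_max)` for all `i`; equivalently,
`1/m_U ≤ θ_max √n_max / θ_min` where `m_U = min_i ‖U(i,:)‖_F`. -/
theorem dcdfm_U_row_norm_lower_bound
    (n K : ℕ) [NeZero n] [NeZero K] (hKn : K ≤ n)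
    (ℓ : Fin n → Fin K) (hℓ : Function.Surjective ℓ)
    (Z : Matrix (Fin n) (Fin K) ℝ)
    (hZ : ∀ i k, Z i k = if ℓ i = k then 1 else 0)
    (P : Matrix (Fin K) (Fin K) ℝ)
    (hPsymm : P.IsSymm) (hPrank : P.rank = K)
    (hPle : ∀ k l, |P k l| ≤ 1) (hPeq : ∃ k l, |P k l| = 1)
    (θ : Fin n → ℝ) (hθ : ∀ i, 0 < θ i)
    (Om : Matrix (Fin n) (Fin n) ℝ)
    (hOm : Om = Matrix.diagonal θ * Z * P * Zᵀ * Matrix.diagonal θ)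
    (U : Matrix (Fin n) (Fin K) ℝ)
    (Λ : Matrix (Fin K) (Fin K) ℝ) (d : Fin K → ℝ)
    (hΛ : Λ = Matrix.diagonal d) (hd : ∀ k, d k ≠ 0)
    (hU : Uᵀ * U = 1)
    (hdec : Om = U * Λ * Uᵀ)
    (θmin θmax : ℝ)
    (hθmin : θmin = Finset.univ.inf' Finset.univ_nonempty θ)
    (hθmax : θmax = Finset.univ.sup' Finset.univ_nonempty θ)
    (nmax : ℕ)
    (hnmax : nmax = Finset.univ.sup' Finset.univ_nonempty
        fun k => (Finset.univ.filter fun i => ℓ i = k).card) :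
    (∀ i, θmin / (θmax * Real.sqrt nmax) ≤ rowNorm (U i)) ∧
      1 / (Finset.univ.inf' Finset.univ_nonempty fun i => rowNorm (U i))
        ≤ θmax * Real.sqrt nmax / θmin := by
  have hmin : ∀ i, θmin ≤ θ i := fun i => hθmin ▸ Finset.inf'_le θ (Finset.mem_univ i)
  have hmax : ∀ i, θ i ≤ θmax := fun i => hθmax ▸ Finset.le_sup' θ (Finset.mem_univ i)
  have hmin_pos : 0 < θmin := by
    rw [hθmin, Finset.lt_inf'_iff]
    exact fun i _ => hθ i
  have hmax_pos : 0 < θmax := (hθ 0).trans_le (hmax 0)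
  have hcard : ∀ k, (Finset.univ.filter fun i => ℓ i = k).card ≤ nmax := fun k =>
    hnmax ▸ Finset.le_sup' (fun k => (Finset.univ.filter fun i => ℓ i = k).card)
      (Finset.mem_univ k)
  have hnmax_pos : 0 < (nmax : ℝ) := by
    have h : 0 < (Finset.univ.filter fun i => ℓ i = ℓ 0).card :=
      Finset.card_pos.mpr ⟨0, by simp⟩
    exact_mod_cast h.trans_le (hcard _)
  have hden_pos : 0 < θmax * Real.sqrt nmax := mul_pos hmax_pos (Real.sqrt_pos.mpr hnmax_pos)
  have hΛinv : Λ * Matrix.diagonal (fun k => (d k)⁻¹) = 1 := by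
    rw [hΛ, Matrix.diagonal_mul_diagonal]
    simp [hd]
  have hfactor : U = (Matrix.diagonal θ * Z) *
      (P * Zᵀ * Matrix.diagonal θ * U * Matrix.diagonal fun k => (d k)⁻¹) := by
    calc U = U * (Λ * ((Uᵀ * U) * Matrix.diagonal fun k => (d k)⁻¹)) := by
          rw [hU, Matrix.one_mul, hΛinv, Matrix.mul_one]
      _ = Om * U * Matrix.diagonal fun k => (d k)⁻¹ := by
          rw [hdec]
          simp only [Matrix.mul_assoc]
      _ = _ := by
          rw [hOm]
          simp only [Matrix.mul_assoc]
  have hrow : ∀ i, θmin / (θmax * Real.sqrt nmax) ≤ rowNorm (U i) := by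
    intro i
    have hsq := row_sq_mul_community_sum ℓ θ _ U _
      (fun i k => by simp [Matrix.diagonal_mul, hZ]) hfactor hU i
    have hsum : ∑ j with ℓ j = ℓ i, θ j ^ 2 ≤ nmax * θmax ^ 2 := by
      calc ∑ j with ℓ j = ℓ i, θ j ^ 2
          ≤ (Finset.univ.filter fun j => ℓ j = ℓ i).card • θmax ^ 2 :=
            Finset.sum_le_card_nsmul _ _ _ fun j _ => pow_le_pow_left₀ (hθ j).le (hmax j) 2
        _ ≤ nmax * θmax ^ 2 := by
            rw [nsmul_eq_mul]
            gcongr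
            exact hcard _
    have hnonneg : 0 ≤ ∑ k, U i k ^ 2 := Finset.sum_nonneg fun k _ => sq_nonneg _
    refine Real.le_sqrt_of_sq_le ?_
    rw [div_pow, mul_pow, Real.sq_sqrt hnmax_pos.le, div_le_iff₀ (by positivity)]
    calc θmin ^ 2 ≤ θ i ^ 2 := pow_le_pow_left₀ hmin_pos.le (hmin i) 2
      _ = (∑ k, U i k ^ 2) * ∑ j with ℓ j = ℓ i, θ j ^ 2 := hsq.symm
      _ ≤ (∑ k, U i k ^ 2) * (nmax * θmax ^ 2) := mul_le_mul_of_nonneg_left hsum hnonneg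
      _ = (∑ k, U i k ^ 2) * (θmax ^ 2 * nmax) := by ring
  refine ⟨hrow, ?_⟩
  rw [← one_div_div θmin]
  exact one_div_le_one_div_of_le (div_pos hmin_pos hden_pos)
    (Finset.le_inf' _ _ fun i _ => hrow i)
end

section
/- Under DCDFM, the matrix B̃ = P Zᵀ Θ U Λ^{-1} ∈ ℝ^{K×K} satisfies B̃ᵀ (Zᵀ Θ² Z) B̃ = I_K; consequently, the rows of B̃ are pairwise orthogonal, and for each k ∈ {1,…,K}, ‖B̃(k,:)‖² = 1/Σ_{i∈C_k} θ(i)². -/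
open Matrix

/-- The weighted Gram matrix of a membership matrix is diagonal, with the sums of squared
weights over the communities as diagonal entries. -/
theorem membership_gram_eq_diagonal {ι κ R : Type*} [Fintype ι] [DecidableEq ι]
    [DecidableEq κ] [CommSemiring R] (ℓ : ι → κ) (Z : Matrix ι κ R)
    (hZ : ∀ i k, Z i k = if ℓ i = k then 1 else 0) (θ : ι → R) :
    Zᵀ * (Matrix.diagonal θ * Matrix.diagonal θ) * Z =
      Matrix.diagonal fun k => ∑ i ∈ Finset.univ.filter fun i => ℓ i = k, θ i ^ 2 := by
  ext k l
  rw [Matrix.diagonal_mul_diagonal, Matrix.mul_apply, Matrix.diagonal_apply, Finset.sum_filter]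
  simp only [Matrix.mul_diagonal, Matrix.transpose_apply, hZ]
  split_ifs with hkl
  · subst hkl
    refine Finset.sum_congr rfl fun i _ => ?_
    split_ifs <;> ring
  · refine Finset.sum_eq_zero fun i _ => ?_
    by_cases hk : ℓ i = k
    · have hl : ℓ i ≠ l := fun hl => hkl (hk.symm.trans hl)
      simp [hl]
    · simp [hk]

/-- Under DCDFM, the matrix `B̃ = P Zᵀ Θ U Λ⁻¹` satisfies `B̃ᵀ (Zᵀ Θ² Z) B̃ = I_K`;
consequently, the rows of `B̃` are pairwise orthogonal and the squared norm of the
`k`-th row equals `1/Σ_{i∈C_k} θ(i)²`. -/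
theorem dcdfm_Btilde_weighted_orthogonality
    (n K : ℕ) [NeZero n] [NeZero K] (hKn : K ≤ n)
    (ℓ : Fin n → Fin K) (hℓ : Function.Surjective ℓ)
    (Z : Matrix (Fin n) (Fin K) ℝ)
    (hZ : ∀ i k, Z i k = if ℓ i = k then 1 else 0)
    (P : Matrix (Fin K) (Fin K) ℝ)
    (hPsymm : P.IsSymm) (hPrank : P.rank = K)
    (hPle : ∀ k l, |P k l| ≤ 1) (hPeq : ∃ k l, |P k l| = 1)
    (θ : Fin n → ℝ) (hθ : ∀ i, 0 < θ i)
    (Om : Matrix (Fin n) (Fin n) ℝ)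
    (hOm : Om = Matrix.diagonal θ * Z * P * Zᵀ * Matrix.diagonal θ)
    (U : Matrix (Fin n) (Fin K) ℝ)
    (Λ : Matrix (Fin K) (Fin K) ℝ) (d : Fin K → ℝ)
    (hΛ : Λ = Matrix.diagonal d) (hd : ∀ k, d k ≠ 0)
    (hU : Uᵀ * U = 1)
    (hdec : Om = U * Λ * Uᵀ)
    (Btil : Matrix (Fin K) (Fin K) ℝ)
    (hBtil : Btil = P * Zᵀ * Matrix.diagonal θ * U * Λ⁻¹) :
    Btilᵀ * (Zᵀ * (Matrix.diagonal θ * Matrix.diagonal θ) * Z) * Btil = 1 ∧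
      (∀ k l, k ≠ l → ∑ m, Btil k m * Btil l m = 0) ∧
      ∀ k, ∑ m, Btil k m ^ 2
          = 1 / ∑ i ∈ Finset.univ.filter fun i => ℓ i = k, θ i ^ 2 := by
  have hΛdet : IsUnit Λ.det := by
    rw [hΛ, Matrix.det_diagonal]
    exact (Finset.prod_ne_zero_iff.mpr fun k _ => hd k).isUnit
  have hUB : Matrix.diagonal θ * Z * Btil = U := by
    calc Matrix.diagonal θ * Z * Btil = Om * U * Λ⁻¹ := by
          rw [hBtil, hOm]; simp only [Matrix.mul_assoc]
      _ = U * Λ * (Uᵀ * U) * Λ⁻¹ := by rw [hdec]; simp only [Matrix.mul_assoc]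
      _ = U := by rw [hU, Matrix.mul_one, Matrix.mul_nonsing_inv_cancel_right _ _ hΛdet]
  have hgram : Btilᵀ * (Zᵀ * (Matrix.diagonal θ * Matrix.diagonal θ) * Z) * Btil = 1 := by
    rw [← hU, ← hUB]
    simp only [Matrix.transpose_mul, Matrix.diagonal_transpose, Matrix.mul_assoc]
  have hrows : ∀ k l, (∑ m, Btil k m * Btil l m) *
      (∑ i ∈ Finset.univ.filter fun i => ℓ i = l, θ i ^ 2) = if k = l then 1 else 0 := by
    intro k l
    have h := mul_eq_one_comm.mp hgram
    rw [membership_gram_eq_diagonal ℓ Z hZ θ, ← Matrix.mul_assoc] at h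
    have hkl := congrFun₂ h k l
    rwa [Matrix.mul_diagonal, Matrix.mul_apply, Matrix.one_apply] at hkl
  refine ⟨hgram, fun k l hkl => ?_, fun k => ?_⟩
  · have hl := hrows l l
    rw [if_pos rfl] at hl
    exact (mul_eq_zero.mp ((hrows k l).trans (if_neg hkl))).resolve_right
      (right_ne_zero_of_mul_eq_one hl)
  · have hk := hrows k k
    rw [if_pos rfl] at hk
    simp only [pow_two (Btil k _)]
    exact eq_one_div_of_mul_eq_one_left hk
end

section
/- Under DCDFM, the K×K matrix B = U_*(𝓘,:) (where 𝓘 contains exactly one node index from each community) has orthonormal rows, and for all k ≠ l in {1,…,K}, ‖B(k,:) − B(l,:)‖_F = √2. -/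
open Matrix

/-- If `A` has orthogonal columns and `A * W` has orthonormal columns, with `W` square, then
distinct rows of `W` are orthogonal. -/
theorem mul_transpose_apply_eq_zero_of_transpose_mul_eq_diagonal {m k : Type*}
    [Fintype m] [Fintype k] [DecidableEq k] {A : Matrix m k ℝ} {W : Matrix k k ℝ} {s : k → ℝ}
    (hA : Aᵀ * A = diagonal s) (hAW : (A * W)ᵀ * (A * W) = 1) {a b : k} (hab : a ≠ b) :
    (W * Wᵀ) a b = 0 := by
  have h : (Wᵀ * diagonal s) * W = 1 := by
    rw [← hAW, ← hA, transpose_mul]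
    simp only [Matrix.mul_assoc]
  have h' : (W * Wᵀ) * diagonal s = 1 := by
    rw [Matrix.mul_assoc]
    exact mul_eq_one_comm.mp h
  have hoff : (W * Wᵀ) a b * s b = 0 := by
    rw [← mul_diagonal, h', one_apply_ne hab]
  have hdiag : (W * Wᵀ) b b * s b = 1 := by
    rw [← mul_diagonal, h', one_apply_eq]
  exact (mul_eq_zero.mp hoff).resolve_right (right_ne_zero_of_mul_eq_one hdiag)

/-- A scaled membership matrix has orthogonal columns. -/
theorem transpose_mul_self_scaled_membership {m k : Type*} [Fintype m] [DecidableEq m]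
    [DecidableEq k] (ℓ : m → k) (θ : m → ℝ) {Z : Matrix m k ℝ}
    (hZ : ∀ i a, Z i a = if ℓ i = a then 1 else 0) :
    (diagonal θ * Z)ᵀ * (diagonal θ * Z) = diagonal fun a => ∑ i, (θ i * Z i a) ^ 2 := by
  ext a b
  rw [mul_apply]
  simp only [transpose_apply, diagonal_mul]
  rcases eq_or_ne a b with rfl | hab
  · simp only [diagonal_apply_eq, sq]
  · rw [diagonal_apply_ne _ hab]
    refine Finset.sum_eq_zero fun i _ => ?_
    rw [hZ, hZ]
    split_ifs with h₁ h₂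
    · exact absurd (h₁.symm.trans h₂) hab
    all_goals simp

theorem rowNorm_ne_zero {K : ℕ} {v : Fin K → ℝ} (hv : v ≠ 0) : rowNorm v ≠ 0 := by
  intro h
  have hsum : ∑ k, v k ^ 2 = 0 := by rw [← rowNorm_sq, h, zero_pow two_ne_zero]
  refine hv (funext fun k => ?_)
  exact pow_eq_zero_iff two_ne_zero |>.mp
    ((Finset.sum_eq_zero_iff_of_nonneg fun _ _ => sq_nonneg _).mp hsum k (Finset.mem_univ k))

/-- Distinct rows of a matrix with orthonormal rows are at distance `√2`. -/
theorem rowNorm_sub_eq_sqrt_two {ι : Type*} [DecidableEq ι] {K : ℕ} {B : Matrix ι (Fin K) ℝ}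
    (hB : ∀ a b, ∑ m, B a m * B b m = if a = b then 1 else 0) {a b : ι} (hab : a ≠ b) :
    rowNorm (fun m => B a m - B b m) = Real.sqrt 2 := by
  have h : ∑ m, (B a m - B b m) ^ 2
      = ∑ m, B a m * B a m - 2 * ∑ m, B a m * B b m + ∑ m, B b m * B b m := by
    rw [Finset.mul_sum, ← Finset.sum_sub_distrib, ← Finset.sum_add_distrib]
    exact Finset.sum_congr rfl fun m _ => by ring
  rw [rowNorm, h, hB, hB, hB, if_pos rfl, if_pos rfl, if_neg hab]
  norm_num

/-- Under DCDFM, the `K × K` matrix `B = U_*(𝓘,:)` (where `𝓘` contains exactly one node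
index from each community) has orthonormal rows, and for all `k ≠ l`,
`‖B(k,:) − B(l,:)‖_F = √2`. -/
theorem dcdfm_B_orthonormal_rows_and_row_gap
    (n K : ℕ) [NeZero n] [NeZero K] (hKn : K ≤ n)
    (ℓ : Fin n → Fin K) (hℓ : Function.Surjective ℓ)
    (Z : Matrix (Fin n) (Fin K) ℝ)
    (hZ : ∀ i k, Z i k = if ℓ i = k then 1 else 0)
    (P : Matrix (Fin K) (Fin K) ℝ)
    (hPsymm : P.IsSymm) (hPrank : P.rank = K)
    (hPle : ∀ k l, |P k l| ≤ 1) (hPeq : ∃ k l, |P k l| = 1)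
    (θ : Fin n → ℝ) (hθ : ∀ i, 0 < θ i)
    (Om : Matrix (Fin n) (Fin n) ℝ)
    (hOm : Om = Matrix.diagonal θ * Z * P * Zᵀ * Matrix.diagonal θ)
    (U : Matrix (Fin n) (Fin K) ℝ)
    (Λ : Matrix (Fin K) (Fin K) ℝ) (d : Fin K → ℝ)
    (hΛ : Λ = Matrix.diagonal d) (hd : ∀ k, d k ≠ 0)
    (hU : Uᵀ * U = 1)
    (hdec : Om = U * Λ * Uᵀ)
    (hUrow : ∀ i, U i ≠ 0)
    (Ustar : Matrix (Fin n) (Fin K) ℝ)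
    (hUstar : Ustar = Matrix.of fun i k => U i k / rowNorm (U i))
    (𝓘 : Fin K → Fin n) (h𝓘 : ∀ k, ℓ (𝓘 k) = k)
    (B : Matrix (Fin K) (Fin K) ℝ)
    (hB : B = Matrix.of fun k => Ustar (𝓘 k)) :
    (∀ k l, ∑ m, B k m * B l m = if k = l then 1 else 0) ∧
      ∀ k l, k ≠ l → rowNorm (fun m => B k m - B l m) = Real.sqrt 2 := by
  have hUW : ∃ W : Matrix (Fin K) (Fin K) ℝ, U = diagonal θ * Z * W := by
    have hΛinv : Λ * diagonal (fun k => (d k)⁻¹) = 1 := by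
      rw [hΛ, diagonal_mul_diagonal, ← diagonal_one]
      exact congrArg diagonal (funext fun k => mul_inv_cancel₀ (hd k))
    refine ⟨P * Zᵀ * diagonal θ * U * diagonal (fun k => (d k)⁻¹), ?_⟩
    calc U = U * Λ * (Uᵀ * U) * diagonal (fun k => (d k)⁻¹) := by
          rw [hU, Matrix.mul_one, Matrix.mul_assoc, hΛinv, Matrix.mul_one]
      _ = Om * U * diagonal (fun k => (d k)⁻¹) := by
          rw [hdec]
          simp only [Matrix.mul_assoc]
      _ = _ := by
          rw [hOm]
          simp only [Matrix.mul_assoc]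
  obtain ⟨W, hW⟩ := hUW
  have hrow : ∀ k m, U (𝓘 k) m = θ (𝓘 k) * W k m := by
    intro k m
    rw [hW, Matrix.mul_assoc, diagonal_mul, mul_apply]
    simp [hZ, h𝓘]
  have hBU : ∀ k m, B k m = U (𝓘 k) m / rowNorm (U (𝓘 k)) := by
    intro k m
    rw [hB, hUstar]
    rfl
  have horth : ∀ k l, ∑ m, B k m * B l m = if k = l then 1 else 0 := by
    intro k l
    rcases eq_or_ne k l with rfl | hkl
    · rw [if_pos rfl]
      have hne := pow_ne_zero 2 (rowNorm_ne_zero (hUrow (𝓘 k)))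
      calc ∑ m, B k m * B k m = (∑ m, U (𝓘 k) m ^ 2) / rowNorm (U (𝓘 k)) ^ 2 := by
            rw [Finset.sum_div]
            exact Finset.sum_congr rfl fun m _ => by rw [hBU]; ring
        _ = 1 := by rw [← rowNorm_sq, div_self hne]
    · rw [if_neg hkl]
      have hzero : (W * Wᵀ) k l = 0 :=
        mul_transpose_apply_eq_zero_of_transpose_mul_eq_diagonal
          (transpose_mul_self_scaled_membership ℓ θ hZ) (hW ▸ hU) hkl
      calc ∑ m, B k m * B l m
          = θ (𝓘 k) / rowNorm (U (𝓘 k)) * (θ (𝓘 l) / rowNorm (U (𝓘 l))) * (W * Wᵀ) k l := by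
            rw [mul_apply, Finset.mul_sum]
            refine Finset.sum_congr rfl fun m _ => ?_
            rw [hBU, hBU, hrow, hrow, transpose_apply]
            ring
        _ = 0 := by rw [hzero, mul_zero]
  exact ⟨horth, fun k l hkl => rowNorm_sub_eq_sqrt_two horth hkl⟩
end
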